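/- Let F_q be a finite field with q elements and ω₁(f) the number of monic irreducible factors of f with multiplicity exactly 1. As n → ∞, Σ_{f ∈ M_n} ω₁(f)² = q^n(log n)² + c₂ q^n log n + c₃ q^n + O(q^n (log n)/n), where c₂ = 1 + 2A₁ - 2L(2) and c₃ = (A₁ - 2L(2))(A₁ + 1) - π²/6 + L(2)² + 2L(3) - L(4). -/

import Mathlib

open Filter Asymptotics Real Polynomial

/-- number of monic irreducible polynomials of degree r in F[t] -/
noncomputable def piq (F : Type*) [Field F] [Fintype F] (r : ℕ) : ℕ :=
  Nat.card {l : Polynomial F // l.Monic ∧ Irreducible l ∧ l.natDegree = r}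

/-- the constant A₁ = γ + Σ_{r≥1} (π_q(r) - q^r/r) q^{-r} -/
noncomputable def A1 (F : Type*) [Field F] [Fintype F] : ℝ :=
  Real.eulerMascheroniConstant +
    ∑' r : ℕ, if r = 0 then 0 else
      ((piq F r : ℝ) - (Fintype.card F : ℝ) ^ r / r) * ((Fintype.card F : ℝ) ^ r)⁻¹

/-- L(m) = Σ_{l ∈ P} |l|^{-m} -/
noncomputable def Lc (F : Type*) [Field F] [Fintype F] (m : ℕ) : ℝ :=
  ∑' l : {l : Polynomial F // l.Monic ∧ Irreducible l},
    (((Fintype.card F : ℝ) ^ (l : Polynomial F).natDegree) ^ m)⁻¹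

/-- ω_k(f): the number of distinct monic irreducible factors of f with multiplicity exactly k -/
noncomputable def omegak (F : Type*) [Field F] [Fintype F] (k : ℕ) (f : Polynomial F) : ℕ :=
  Nat.card {l : Polynomial F // l.Monic ∧ Irreducible l ∧ l ^ k ∣ f ∧ ¬ l ^ (k + 1) ∣ f}


section Comb
variable (F : Type*) [Field F] [Fintype F]

lemma finite_le (n : ℕ) : {f : F[X] | f.natDegree ≤ n}.Finite := by
  have h : {f : F[X] | f.natDegree ≤ n} = (Polynomial.degreeLE F n : Set F[X]) := by
    ext f
    simp [Polynomial.mem_degreeLE, Polynomial.natDegree_le_iff_degree_le]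
  rw [h]
  rw [show Polynomial.degreeLE F n = Polynomial.degreeLT F (n+1) by
    ext f
    rw [Polynomial.mem_degreeLE, Polynomial.mem_degreeLT, ← Polynomial.natDegree_le_iff_degree_le]
    rw [Polynomial.degree_lt_iff_coeff_zero, Polynomial.natDegree_le_iff_coeff_eq_zero]
    constructor
    · intro h m hm
      exact h m (by omega)
    · intro h m hm
      exact h m (by omega)]
  have := Finite.of_equiv _ (Polynomial.degreeLTEquiv F (n+1)).toEquiv.symm
  exact Set.toFinite _

lemma finite_Mn (n : ℕ) : {f : F[X] | f.Monic ∧ f.natDegree = n}.Finite :=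
  (finite_le F n).subset (fun _ h => h.2.le)

lemma finite_In (n : ℕ) : {l : F[X] | l.Monic ∧ Irreducible l ∧ l.natDegree ≤ n}.Finite :=
  (finite_le F n).subset (fun _ h => h.2.2)

noncomputable def Mn (n : ℕ) : Finset F[X] := (finite_Mn F n).toFinset
noncomputable def In (n : ℕ) : Finset F[X] := (finite_In F n).toFinset

variable {F}
lemma mem_Mn {n : ℕ} {f : F[X]} : f ∈ Mn F n ↔ f.Monic ∧ f.natDegree = n := by simp [Mn]
lemma mem_In {n : ℕ} {f : F[X]} : f ∈ In F n ↔ f.Monic ∧ Irreducible f ∧ f.natDegree ≤ n := by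
  simp [In]
variable (F)

lemma card_Mn (n : ℕ) : (Mn F n).card = Fintype.card F ^ n := by
  classical
  have e : Nat.card (Polynomial.degreeLT F n) = Fintype.card F ^ n := by
    rw [Nat.card_congr (Polynomial.degreeLTEquiv F n).toEquiv]
    simp
  have hfin : Finite (Polynomial.degreeLT F n) :=
    Finite.of_equiv _ (Polynomial.degreeLTEquiv F n).toEquiv.symm
  have : Fintype (Polynomial.degreeLT F n) := Fintype.ofFinite _
  rw [← e, Nat.card_eq_fintype_card, ← Finset.card_univ]
  symm
  apply Finset.card_bij (fun (g : Polynomial.degreeLT F n) _ => X ^ n + (g : F[X]))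
  · rintro ⟨g, hg⟩ -
    rw [Polynomial.mem_degreeLT] at hg
    rw [mem_Mn]
    exact ⟨Polynomial.monic_X_pow_add hg, by
      rw [Polynomial.natDegree_add_eq_left_of_degree_lt (by simpa using hg), natDegree_X_pow]⟩
  · rintro a - b - h
    exact Subtype.ext (add_left_cancel h)
  · intro f hf
    rw [mem_Mn] at hf
    refine ⟨⟨f - X ^ n, ?_⟩, Finset.mem_univ _, by simp⟩
    rw [Polynomial.mem_degreeLT]
    have hd : f.degree = n := by rw [Polynomial.degree_eq_natDegree hf.1.ne_zero, hf.2]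
    rw [← hd]
    apply Polynomial.degree_sub_lt
    · rw [hd, degree_X_pow]
    · exact hf.1.ne_zero
    · rw [hf.1.leadingCoeff, (monic_X_pow n).leadingCoeff]

open Classical in
lemma card_dvd (n : ℕ) (g : F[X]) (hg : g.Monic) :
    ((Mn F n).filter (fun f => g ∣ f)).card =
      if g.natDegree ≤ n then Fintype.card F ^ (n - g.natDegree) else 0 := by
  split_ifs with h
  · rw [← card_Mn]
    symm
    apply Finset.card_bij (fun f _ => g * f)
    · intro f hf
      rw [mem_Mn] at hf
      rw [Finset.mem_filter, mem_Mn]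
      refine ⟨⟨hg.mul hf.1, ?_⟩, Dvd.intro _ rfl⟩
      rw [hg.natDegree_mul hf.1, hf.2]; omega
    · intro a _ b _ hab
      exact mul_left_cancel₀ hg.ne_zero hab
    · intro f hf
      rw [Finset.mem_filter, mem_Mn] at hf
      obtain ⟨⟨hm, hn⟩, k, rfl⟩ := hf
      have hk : k.Monic := hg.of_mul_monic_left hm
      refine ⟨k, ?_, rfl⟩
      rw [mem_Mn]
      refine ⟨hk, ?_⟩
      rw [hg.natDegree_mul hk] at hn
      omega
  · rw [Finset.card_eq_zero, Finset.filter_eq_empty_iff]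
    intro f hf hd
    rw [mem_Mn] at hf
    have := Polynomial.natDegree_le_of_dvd hd hf.1.ne_zero
    omega

/-- normalized count of multiples -/
noncomputable def cc (n m : ℕ) : ℝ := if m ≤ n then ((Fintype.card F : ℝ) ^ m)⁻¹ else 0

open Classical in
lemma sum_ind_dvd (n : ℕ) (g : F[X]) (hg : g.Monic) :
    (∑ f ∈ Mn F n, if g ∣ f then (1:ℝ) else 0) = (Fintype.card F : ℝ) ^ n * cc F n g.natDegree := by
  rw [Finset.sum_boole, card_dvd F n g hg, cc]
  have hq : (Fintype.card F : ℝ) ≠ 0 := by simp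
  split_ifs with h
  · push_cast
    rw [pow_sub₀ _ hq h]
  · simp

open Classical in
noncomputable def uu (l f : F[X]) : ℝ := (if l ∣ f then 1 else 0) - (if l ^ 2 ∣ f then 1 else 0)

lemma uu_eq (l f : F[X]) : uu F l f = (open Classical in if l ∣ f ∧ ¬ l ^ 2 ∣ f then (1:ℝ) else 0) := by
  classical
  unfold uu
  by_cases h2 : l ^ 2 ∣ f
  · have h1 : l ∣ f := (dvd_pow_self l two_ne_zero).trans h2
    simp [h1, h2]
  · simp [h2]

lemma omegak_eq (n : ℕ) (f : F[X]) (hf : f ∈ Mn F n) :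
    (omegak F 1 f : ℝ) = ∑ l ∈ In F n, uu F l f := by
  classical
  simp_rw [uu_eq]
  rw [Finset.sum_boole, omegak]
  congr 1
  apply Nat.subtype_card
  intro l
  rw [Finset.mem_filter, mem_In, pow_one]
  rw [mem_Mn] at hf
  constructor
  · rintro ⟨⟨h1, h2, h3⟩, h4, h5⟩
    exact ⟨h1, h2, h4, h5⟩
  · rintro ⟨h1, h2, h4, h5⟩
    refine ⟨⟨h1, h2, ?_⟩, h4, h5⟩
    rw [← hf.2]
    exact Polynomial.natDegree_le_of_dvd h4 hf.1.ne_zero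

lemma sum_uu (n : ℕ) (l : F[X]) (hl : l.Monic) :
    ∑ f ∈ Mn F n, uu F l f = (Fintype.card F : ℝ) ^ n *
      (cc F n l.natDegree - cc F n (2 * l.natDegree)) := by
  classical
  simp_rw [uu, Finset.sum_sub_distrib]
  rw [sum_ind_dvd F n l hl, sum_ind_dvd F n _ (hl.pow 2), hl.natDegree_pow]
  ring

lemma ind_mul (n : ℕ) (a b : F[X]) (ha : a.Monic) (hb : b.Monic) (hab : IsCoprime a b) :
    (open Classical in ∑ f ∈ Mn F n, (if a ∣ f then (1:ℝ) else 0) * (if b ∣ f then (1:ℝ) else 0))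
     = (Fintype.card F : ℝ) ^ n * cc F n (a.natDegree + b.natDegree) := by
  classical
  rw [← ha.natDegree_mul hb, ← sum_ind_dvd F n _ (ha.mul hb)]
  refine Finset.sum_congr rfl fun f _ => ?_
  have : a * b ∣ f ↔ a ∣ f ∧ b ∣ f :=
    ⟨fun h => ⟨(Dvd.intro _ rfl).trans h, (Dvd.intro_left _ rfl).trans h⟩,
      fun h => hab.mul_dvd h.1 h.2⟩
  by_cases h1 : a ∣ f <;> by_cases h2 : b ∣ f <;> simp [this, h1, h2]

/-- the pair weight -/
noncomputable def ww (n d e : ℕ) : ℝ :=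
  cc F n (d + e) - cc F n (d + 2 * e) - cc F n (2 * d + e) + cc F n (2 * d + 2 * e)

lemma sum_uu_uu (n : ℕ) (l l' : F[X]) (hl : l.Monic) (hl' : l'.Monic) (hi : Irreducible l)
    (hi' : Irreducible l') (hne : l ≠ l') :
    ∑ f ∈ Mn F n, uu F l f * uu F l' f = (Fintype.card F : ℝ) ^ n * ww F n l.natDegree l'.natDegree := by
  classical
  have hc : IsCoprime l l' := by
    rcases hi.isCoprime_or_dvd l' with h | h
    · exact h
    · exact absurd (Polynomial.eq_of_monic_of_associated hl hl' (hi.associated_of_dvd hi' h)) hne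
  have h11 := ind_mul F n l l' hl hl' hc
  have h12 := ind_mul F n l (l' ^ 2) hl (hl'.pow 2) hc.pow_right
  have h21 := ind_mul F n (l ^ 2) l' (hl.pow 2) hl' hc.pow_left
  have h22 := ind_mul F n (l ^ 2) (l' ^ 2) (hl.pow 2) (hl'.pow 2) hc.pow
  rw [hl'.natDegree_pow] at h12 h22
  rw [hl.natDegree_pow] at h21 h22
  rw [ww, mul_add, mul_sub, mul_sub, ← h11, ← h12, ← h21, ← h22, ← Finset.sum_sub_distrib,
    ← Finset.sum_sub_distrib, ← Finset.sum_add_distrib]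
  refine Finset.sum_congr rfl fun f _ => ?_
  rw [uu, uu]; ring

lemma uu_sq (l f : F[X]) : uu F l f * uu F l f = uu F l f := by
  classical
  rw [uu_eq]; split_ifs <;> simp

lemma moment_comb (n : ℕ) :
    (∑ᶠ f ∈ {f : Polynomial F | f.Monic ∧ f.natDegree = n}, (omegak F 1 f : ℝ) ^ 2) =
    (Fintype.card F : ℝ) ^ n * ((∑ l ∈ In F n, ∑ l' ∈ In F n, ww F n l.natDegree l'.natDegree)
      - (∑ l ∈ In F n, ww F n l.natDegree l.natDegree)
      + ∑ l ∈ In F n, (cc F n l.natDegree - cc F n (2 * l.natDegree))) := by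
  classical
  have h0 : {f : Polynomial F | f.Monic ∧ f.natDegree = n} = (Mn F n : Set F[X]) := by
    ext f; simp [mem_Mn]
  rw [h0, finsum_mem_coe_finset]
  have h1 : ∑ f ∈ Mn F n, (omegak F 1 f : ℝ) ^ 2 =
      ∑ f ∈ Mn F n, ∑ l ∈ In F n, ∑ l' ∈ In F n, uu F l f * uu F l' f := by
    refine Finset.sum_congr rfl fun f hf => ?_
    rw [omegak_eq F n f hf, sq, Finset.sum_mul_sum]
  rw [h1, Finset.sum_comm]
  rw [← Finset.sum_sub_distrib, ← Finset.sum_add_distrib, Finset.mul_sum]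
  refine Finset.sum_congr rfl fun l hl => ?_
  rw [Finset.sum_comm, ← Finset.add_sum_erase _ _ hl,
    ← Finset.add_sum_erase (In F n) (fun l' => ww F n l.natDegree l'.natDegree) hl]
  simp_rw [uu_sq]
  have hl' := mem_In.1 hl
  rw [sum_uu F n l hl'.1]
  have : ∀ l' ∈ (In F n).erase l, ∑ f ∈ Mn F n, uu F l f * uu F l' f =
      (Fintype.card F : ℝ) ^ n * ww F n l.natDegree l'.natDegree := by
    intro l' h
    rw [Finset.mem_erase, mem_In] at h
    exact sum_uu_uu F n l l' hl'.1 h.2.1 hl'.2.1 h.2.2.1 h.1.symm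
  rw [Finset.sum_congr rfl this, ← Finset.mul_sum]
  ring
end Comb

section Group
variable (F : Type*) [Field F] [Fintype F]

noncomputable def NN (k m : ℕ) : ℕ :=
  Nat.card {l : F[X] // l.Monic ∧ Irreducible l ∧ k * l.natDegree = m}

noncomputable def bb (k m : ℕ) : ℝ := (NN F k m : ℝ) * ((Fintype.card F : ℝ) ^ m)⁻¹

noncomputable def SS (a b : ℕ → ℝ) (n : ℕ) : ℝ :=
  ∑ i ∈ Finset.range (n + 1), ∑ j ∈ Finset.range (n + 1), if i + j ≤ n then a i * b j else 0

lemma NN_eq (k m n : ℕ) (hk : 1 ≤ k) (hm : m ≤ n) :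
    NN F k m = ((In F n).filter (fun l => k * l.natDegree = m)).card := by
  apply Nat.subtype_card
  intro l
  rw [Finset.mem_filter, mem_In]
  constructor
  · rintro ⟨⟨h1, h2, h3⟩, h4⟩
    exact ⟨h1, h2, h4⟩
  · rintro ⟨h1, h2, h4⟩
    refine ⟨⟨h1, h2, ?_⟩, h4⟩
    have : 1 * l.natDegree ≤ k * l.natDegree := Nat.mul_le_mul_right _ hk
    omega

lemma group (k n : ℕ) (hk : 1 ≤ k) (φ : ℕ → ℝ) :
    ∑ l ∈ In F n, (if k * l.natDegree ≤ n then φ (k * l.natDegree) else 0) =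
      ∑ m ∈ Finset.range (n + 1), (NN F k m : ℝ) * φ m := by
  have : ∀ m ∈ Finset.range (n + 1), (NN F k m : ℝ) * φ m =
      ∑ l ∈ In F n, if k * l.natDegree = m then φ m else 0 := by
    intro m hm
    rw [Finset.mem_range] at hm
    rw [NN_eq F k m n hk (by omega), ← Finset.sum_filter, Finset.sum_const, nsmul_eq_mul]
  rw [Finset.sum_congr rfl this, Finset.sum_comm]
  refine Finset.sum_congr rfl fun l _ => ?_
  rw [Finset.sum_ite_eq]
  simp [Nat.lt_succ_iff]

lemma group_cc (k n : ℕ) (hk : 1 ≤ k) :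
    ∑ l ∈ In F n, cc F n (k * l.natDegree) = ∑ m ∈ Finset.range (n + 1), bb F k m := by
  exact group F k n hk (fun m => ((Fintype.card F : ℝ) ^ m)⁻¹)

lemma group_pair (k k' n : ℕ) (hk : 1 ≤ k) (hk' : 1 ≤ k') :
    ∑ l ∈ In F n, ∑ l' ∈ In F n, cc F n (k * l.natDegree + k' * l'.natDegree) =
      SS (bb F k) (bb F k') n := by
  have h1 : ∀ a : ℕ, ∑ l' ∈ In F n, cc F n (a + k' * l'.natDegree) =
      ∑ m ∈ Finset.range (n + 1), (NN F k' m : ℝ) * cc F n (a + m) := by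
    intro a
    rw [← group F k' n hk' (fun m => cc F n (a + m))]
    refine Finset.sum_congr rfl fun l _ => ?_
    split_ifs with h
    · rfl
    · rw [cc, if_neg (by omega)]
  simp_rw [h1]
  have h2 : ∑ l ∈ In F n, ∑ m ∈ Finset.range (n + 1), (NN F k' m : ℝ) * cc F n (k * l.natDegree + m)
    = ∑ i ∈ Finset.range (n + 1), (NN F k i : ℝ) *
      ∑ m ∈ Finset.range (n + 1), (NN F k' m : ℝ) * cc F n (i + m) := by
    rw [← group F k n hk
      (fun i => ∑ m ∈ Finset.range (n + 1), (NN F k' m : ℝ) * cc F n (i + m))]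
    refine Finset.sum_congr rfl fun l _ => ?_
    split_ifs with h
    · rfl
    · apply Finset.sum_eq_zero
      intro m _
      rw [cc, if_neg (by omega), mul_zero]
  rw [h2, SS]
  refine Finset.sum_congr rfl fun i _ => ?_
  rw [Finset.mul_sum]
  refine Finset.sum_congr rfl fun j _ => ?_
  rw [cc]
  split_ifs
  · rw [bb, bb, pow_add, mul_inv]; ring
  · ring

lemma SS_sub_left (a b c : ℕ → ℝ) (n : ℕ) : SS (fun i => a i - b i) c n = SS a c n - SS b c n := by
  simp only [SS, ← Finset.sum_sub_distrib]
  refine Finset.sum_congr rfl fun i _ => Finset.sum_congr rfl fun j _ => ?_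
  split_ifs <;> ring

lemma SS_sub_right (a b c : ℕ → ℝ) (n : ℕ) : SS a (fun i => b i - c i) n = SS a b n - SS a c n := by
  simp only [SS, ← Finset.sum_sub_distrib]
  refine Finset.sum_congr rfl fun i _ => Finset.sum_congr rfl fun j _ => ?_
  split_ifs <;> ring

lemma moment_eq (n : ℕ) :
    (∑ᶠ f ∈ {f : Polynomial F | f.Monic ∧ f.natDegree = n}, (omegak F 1 f : ℝ) ^ 2) =
    (Fintype.card F : ℝ) ^ n * (SS (fun m => bb F 1 m - bb F 2 m) (fun m => bb F 1 m - bb F 2 m) n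
      - (∑ m ∈ Finset.range (n + 1), bb F 2 m - 2 * ∑ m ∈ Finset.range (n + 1), bb F 3 m
          + ∑ m ∈ Finset.range (n + 1), bb F 4 m)
      + (∑ m ∈ Finset.range (n + 1), bb F 1 m - ∑ m ∈ Finset.range (n + 1), bb F 2 m)) := by
  rw [moment_comb, SS_sub_left, SS_sub_right, SS_sub_right]
  rw [← group_pair F 1 1 n le_rfl le_rfl, ← group_pair F 1 2 n le_rfl (by norm_num),
    ← group_pair F 2 1 n (by norm_num) le_rfl, ← group_pair F 2 2 n (by norm_num) (by norm_num),
    ← group_cc F 1 n (by norm_num), ← group_cc F 2 n (by norm_num), ← group_cc F 3 n (by norm_num),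
    ← group_cc F 4 n (by norm_num)]
  have hw : ∀ d, ww F n d d = cc F n (2 * d) - 2 * cc F n (3 * d) + cc F n (4 * d) := by
    intro d
    rw [ww, show d + d = 2 * d by ring, show d + 2 * d = 3 * d by ring,
      show 2 * d + d = 3 * d by ring, show 2 * d + 2 * d = 4 * d by ring]
    ring
  simp_rw [hw, ww, Finset.sum_add_distrib, Finset.sum_sub_distrib, Finset.mul_sum, one_mul]
  ring

/-! prime polynomial theorem -/

lemma sum_deg (n : ℕ) (hn : n ≠ 0) :
    ∑ l ∈ (In F n).filter (fun l => l.natDegree ∣ n), l.natDegree = Fintype.card F ^ n := by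
  classical
  have hq : 1 < Fintype.card F ^ n := one_lt_pow₀ Fintype.one_lt_card hn
  set g : F[X] := X ^ Nat.card F ^ n - X with hg
  have hdeg : g.natDegree = Fintype.card F ^ n := by
    rw [hg, Nat.card_eq_fintype_card]
    exact FiniteField.X_pow_card_sub_X_natDegree_eq F hq
  have hmon : g.Monic := by
    rw [hg, Nat.card_eq_fintype_card]
    apply monic_X_pow_sub
    rw [degree_X]; exact_mod_cast hq
  have hsq : Squarefree g := by
    apply Polynomial.Separable.squarefree
    obtain ⟨p, hp⟩ := CharP.exists F
    apply galois_poly_separable p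
    rw [Nat.card_eq_fintype_card]
    apply dvd_pow _ hn
    exact (CharP.cast_eq_zero_iff F p _).1 (by simp)
  have hset : (In F n).filter (fun l => l.natDegree ∣ n) =
      (UniqueFactorizationMonoid.normalizedFactors g).toFinset := by
    ext l
    rw [Finset.mem_filter, mem_In, Multiset.mem_toFinset]
    rw [UniqueFactorizationMonoid.mem_normalizedFactors_iff' hmon.ne_zero]
    constructor
    · rintro ⟨⟨h1, h2, h3⟩, h4⟩
      exact ⟨h2, h1.normalize_eq_self, (h2.natDegree_dvd_iff_dvd_X_pow_card_pow_sub_X).1 h4⟩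
    · rintro ⟨h2, h1, h3⟩
      have h4 := (h2.natDegree_dvd_iff_dvd_X_pow_card_pow_sub_X).2 h3
      refine ⟨⟨?_, h2, Nat.le_of_dvd (by omega) h4⟩, h4⟩
      rw [← h1]
      exact Polynomial.monic_normalize h2.ne_zero
  rw [hset, ← hdeg]
  have hnd := (UniqueFactorizationMonoid.squarefree_iff_nodup_normalizedFactors hmon.ne_zero).1 hsq
  have hprod := UniqueFactorizationMonoid.prod_normalizedFactors_eq hmon.ne_zero
  rw [hmon.normalize_eq_self] at hprod
  conv_rhs => rw [← hprod]
  rw [Polynomial.natDegree_multiset_prod]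
  · rw [Finset.sum, Multiset.toFinset_val, hnd.dedup]
  · intro h
    exact (UniqueFactorizationMonoid.irreducible_of_normalized_factor _ h).ne_zero rfl

lemma piq_eq (n : ℕ) : piq F n = NN F 1 n := by
  simp [piq, NN]

lemma sum_deg' (n : ℕ) (hn : n ≠ 0) :
    ∑ d ∈ n.divisors, d * piq F d = Fintype.card F ^ n := by
  rw [← sum_deg F n hn, Finset.sum_filter]
  have : ∀ d ∈ n.divisors, d * piq F d = ∑ l ∈ In F n, if l.natDegree = d then d else 0 := by
    intro d hd
    rw [piq_eq, NN_eq F 1 d n le_rfl (Nat.divisor_le hd), ← Finset.sum_filter, Finset.sum_const,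
      smul_eq_mul, mul_comm]
    simp
  rw [Finset.sum_congr rfl this, Finset.sum_comm]
  refine Finset.sum_congr rfl fun l _ => ?_
  rw [Finset.sum_ite_eq]
  simp [hn]

lemma piq_zero : piq F 0 = 0 := by
  rw [piq, Nat.card_eq_zero]
  left
  constructor
  rintro ⟨l, h1, h2, h3⟩
  exact h2.natDegree_pos.ne' h3

lemma mul_piq_le (n : ℕ) : n * piq F n ≤ Fintype.card F ^ n := by
  rcases eq_or_ne n 0 with rfl | hn
  · simp
  · rw [← sum_deg' F n hn]
    exact Finset.single_le_sum (f := fun d => d * piq F d) (fun _ _ => Nat.zero_le _)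
      (Nat.mem_divisors_self n hn)

lemma le_mul_piq (n : ℕ) (hn : n ≠ 0) :
    Fintype.card F ^ n ≤ n * piq F n + 2 * Fintype.card F ^ (n / 2) := by
  have hq : 2 ≤ Fintype.card F := Fintype.one_lt_card
  rw [← sum_deg' F n hn, ← Nat.cons_self_properDivisors hn, Finset.sum_cons]
  gcongr
  have h1 : ∑ d ∈ n.properDivisors, d * piq F d ≤ ∑ d ∈ Finset.range (n / 2 + 1), Fintype.card F ^ d := by
    refine (Finset.sum_le_sum fun d _ => mul_piq_le F d).trans ?_
    apply Finset.sum_le_sum_of_subset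
    intro d hd
    rw [Nat.mem_properDivisors] at hd
    rw [Finset.mem_range]
    obtain ⟨⟨c, hc⟩, h⟩ := hd
    have : 2 ≤ c := by
      by_contra hc2
      interval_cases c <;> omega
    have : d * 2 ≤ n := hc ▸ Nat.mul_le_mul_left d this
    omega
  refine h1.trans ?_
  generalize n / 2 = k
  induction k with
  | zero => simp
  | succ k ih =>
    rw [Finset.sum_range_succ]
    have : 2 * Fintype.card F ^ k ≤ Fintype.card F ^ (k + 1) := by
      rw [pow_succ, mul_comm]; exact Nat.mul_le_mul_left _ hq
    omega

noncomputable def rho : ℝ := (√(Fintype.card F : ℝ))⁻¹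

lemma rho_pos : 0 < rho F := by
  unfold rho
  have : (0:ℝ) < Fintype.card F := by exact_mod_cast Fintype.card_pos
  positivity

lemma rho_lt_one : rho F < 1 := by
  unfold rho
  apply inv_lt_one_of_one_lt₀
  rw [Real.lt_sqrt (by norm_num)]
  have : 1 < Fintype.card F := Fintype.one_lt_card
  norm_num
  exact_mod_cast this

lemma q_bound (d m : ℕ) (h : 2 * d ≤ m) :
    (Fintype.card F : ℝ) ^ d * ((Fintype.card F : ℝ) ^ m)⁻¹ ≤ rho F ^ m := by
  have h1 : (1:ℝ) ≤ Fintype.card F := by exact_mod_cast Fintype.card_pos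
  have h2 : √(Fintype.card F : ℝ) ^ 2 = Fintype.card F := Real.sq_sqrt (by linarith)
  have h3 : 1 ≤ √(Fintype.card F : ℝ) := Real.one_le_sqrt.2 h1
  set s := √(Fintype.card F : ℝ) with hs
  rw [rho, ← hs, ← h2, ← pow_mul, ← pow_mul, inv_pow, ← div_eq_mul_inv, div_le_iff₀ (by positivity),
    inv_mul_eq_div, le_div_iff₀ (by positivity), ← pow_add]
  exact pow_le_pow_right₀ h3 (by omega)

lemma bb_bound (k m : ℕ) (hk : 2 ≤ k) : |bb F k m| ≤ rho F ^ m := by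
  have h0 : 0 ≤ bb F k m := by unfold bb; positivity
  rw [abs_of_nonneg h0]
  by_cases hd : k ∣ m
  · obtain ⟨d, rfl⟩ := hd
    refine le_trans ?_ (q_bound F d (k * d) (Nat.mul_le_mul_right _ hk))
    unfold bb
    gcongr
    have : NN F k (k * d) ≤ Fintype.card F ^ d := by
      rw [← card_Mn, NN_eq F k (k * d) (k * d) (by omega) le_rfl]
      apply Finset.card_le_card
      intro l hl
      rw [Finset.mem_filter, mem_In] at hl
      rw [mem_Mn]
      exact ⟨hl.1.1, Nat.eq_of_mul_eq_mul_left (by omega) hl.2⟩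
    exact_mod_cast this
  · have : NN F k m = 0 := by
      rw [NN, Nat.card_eq_zero]
      left
      constructor
      rintro ⟨l, h1, h2, h3⟩
      exact hd ⟨_, h3.symm⟩
    rw [bb, this]
    have := rho_pos F
    simp; positivity

noncomputable def ee (m : ℕ) : ℝ := bb F 1 m - 1 / m

lemma ee_bound (m : ℕ) : |ee F m| ≤ 2 * rho F ^ m := by
  have hr := rho_pos F
  rcases eq_or_ne m 0 with rfl | hm
  · simp [ee, bb, ← piq_eq, piq_zero]
  have h1 : (m : ℝ) * piq F m ≤ (Fintype.card F : ℝ) ^ m := by exact_mod_cast mul_piq_le F m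
  have h2 : (Fintype.card F : ℝ) ^ m ≤ m * piq F m + 2 * (Fintype.card F : ℝ) ^ (m / 2) := by
    exact_mod_cast le_mul_piq F m hm
  have h3 := q_bound F (m / 2) m (by omega)
  have hQ : (0:ℝ) < (Fintype.card F : ℝ) ^ m := by
    have : (0:ℝ) < Fintype.card F := by exact_mod_cast Fintype.card_pos
    positivity
  have hm1 : (1:ℝ) ≤ m := by exact_mod_cast Nat.one_le_iff_ne_zero.2 hm
  have h4 : |(m : ℝ) * ee F m| ≤ 2 * rho F ^ m := by
    have : (m : ℝ) * ee F m = (m * piq F m - (Fintype.card F : ℝ) ^ m) * ((Fintype.card F : ℝ) ^ m)⁻¹ := by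
      rw [ee, bb, ← piq_eq]
      field_simp
    rw [this, abs_mul, abs_of_pos (inv_pos.2 hQ), abs_of_nonpos (by linarith)]
    calc _ ≤ (2 * (Fintype.card F : ℝ) ^ (m / 2)) * ((Fintype.card F : ℝ) ^ m)⁻¹ := by
          gcongr; linarith
      _ ≤ _ := by linarith
  refine le_trans ?_ h4
  rw [abs_mul, abs_of_pos (by linarith : (0:ℝ) < m)]
  exact le_mul_of_one_le_left (abs_nonneg _) hm1

lemma A1_eq : A1 F = Real.eulerMascheroniConstant + ∑' m, ee F m := by
  rw [A1]
  congr 1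
  refine tsum_congr fun r => ?_
  split_ifs with h
  · subst h; simp [ee, bb, ← piq_eq, piq_zero]
  · rw [ee, bb, ← piq_eq]
    have : (Fintype.card F : ℝ) ≠ 0 := by simp
    field_simp

lemma Lc_eq (k : ℕ) (hk : 2 ≤ k) : Lc F k = ∑' m, bb F k m := by
  have hs : Summable (bb F k) := by
    apply Summable.of_norm_bounded (g := fun m => rho F ^ m)
    · exact summable_geometric_of_lt_one (rho_pos F).le (rho_lt_one F)
    · intro m; exact bb_bound F k m hk
  rw [Lc]
  set I := {l : Polynomial F // l.Monic ∧ Irreducible l}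
  let φ : I → ℕ := fun l => k * (l : F[X]).natDegree
  let f : I → ℝ := fun l => (((Fintype.card F : ℝ) ^ (l : Polynomial F).natDegree) ^ k)⁻¹
  have hf : ∀ m, ∀ x : {l : I // φ l = m}, f x.1 = ((Fintype.card F : ℝ) ^ m)⁻¹ := by
    rintro m ⟨x, rfl⟩
    simp only [f, φ]
    rw [← pow_mul, mul_comm]
  have hcard : ∀ m, Nat.card {l : I // φ l = m} = NN F k m := by
    intro m
    apply Nat.card_congr
    refine (Equiv.subtypeSubtypeEquivSubtypeInter (fun l : F[X] => l.Monic ∧ Irreducible l)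
      (fun l => k * l.natDegree = m)).trans (Equiv.subtypeEquivRight fun l => and_assoc)
  have hfin : ∀ m, Finite {l : I // φ l = m} := by
    intro m
    have := (finite_le F m).to_subtype
    apply Finite.of_injective
      (fun x : {l : I // φ l = m} => (⟨x.1.1, by
        obtain ⟨x, hx⟩ := x
        have h1 : k * (x : F[X]).natDegree = m := hx
        have h2 : 1 * (x : F[X]).natDegree ≤ k * (x : F[X]).natDegree :=
          Nat.mul_le_mul_right _ (by omega)
        simp only [Set.mem_setOf_eq]
        omega⟩ : {f : F[X] | f.natDegree ≤ m}))
    intro a b hab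
    have h3 := congrArg Subtype.val hab
    exact Subtype.ext (Subtype.ext h3)
  have hsum : ∀ m, ∑' x : {l : I // φ l = m}, f x.1 = bb F k m := by
    intro m
    simp_rw [hf m]
    rw [tsum_const, hcard, nsmul_eq_mul, bb]
  show ∑' l, f l = _
  rw [← (Equiv.sigmaFiberEquiv φ).tsum_eq f]
  rw [Summable.tsum_sigma']
  · exact tsum_congr hsum
  · intro m
    have := hfin m
    exact Summable.of_finite
  · rw [summable_sigma_of_nonneg]
    · constructor
      · intro m
        have := hfin m
        exact Summable.of_finite
      · exact hs.congr fun m => (hsum m).symm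
    · intro x
      simp only [f]
      positivity
end Group

section Analytic

lemma summable_pow_mul_abs (g : ℕ → ℝ) (C r : ℝ) (hr : 0 ≤ r) (hr1 : r < 1)
    (hg : ∀ m, |g m| ≤ C * r ^ m) (k : ℕ) : Summable (fun m : ℕ => (m : ℝ) ^ k * |g m|) := by
  have h := (summable_pow_mul_geometric_of_norm_lt_one k
    (by rwa [Real.norm_of_nonneg hr] : ‖r‖ < 1)).mul_left C
  refine Summable.of_nonneg_of_le (fun m => by positivity) (fun m => ?_) h
  calc (m : ℝ) ^ k * |g m| ≤ m ^ k * (C * r ^ m) := by gcongr; exact hg m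
    _ = _ := by ring

lemma bigO_of_bound (f : ℕ → ℝ) (K : ℝ) (h : ∀ n : ℕ, 1 ≤ n → (n : ℝ) * |f n| ≤ K) :
    f =O[atTop] (fun n : ℕ => 1 / (n : ℝ)) := by
  apply IsBigO.of_bound K
  filter_upwards [eventually_ge_atTop 1] with n hn
  have hn' : (0 : ℝ) < n := by exact_mod_cast hn
  rw [Real.norm_eq_abs, Real.norm_of_nonneg (by positivity), mul_one_div, le_div_iff₀ hn']
  linarith [h n hn]

/-- L1 -/
lemma partial_sum (g : ℕ → ℝ) (h0 : Summable (fun m : ℕ => |g m|))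
    (h1 : Summable (fun m : ℕ => (m : ℝ) * |g m|)) :
    (fun n : ℕ => ∑ m ∈ Finset.range (n + 1), g m - ∑' m, g m) =O[atTop]
      (fun n : ℕ => 1 / (n : ℝ)) := by
  apply bigO_of_bound _ (∑' m : ℕ, (m : ℝ) * |g m|)
  intro n hn
  have hg : Summable g := h0.of_abs
  have e := hg.sum_add_tsum_nat_add (n + 1)
  have : ∑ m ∈ Finset.range (n + 1), g m - ∑' m, g m = - ∑' i, g (i + (n + 1)) := by linarith
  rw [this, abs_neg]
  have h0' := (summable_nat_add_iff (n + 1)).2 h0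
  have h1' := (summable_nat_add_iff (n + 1)).2 h1
  have hb : |∑' i, g (i + (n + 1))| ≤ ∑' i, |g (i + (n + 1))| := by
    simpa [Real.norm_eq_abs] using norm_tsum_le_tsum_norm (f := fun i => g (i + (n + 1))) (by simpa using h0')
  have e1 := h1.sum_add_tsum_nat_add (n + 1)
  have hpos : 0 ≤ ∑ m ∈ Finset.range (n + 1), (m : ℝ) * |g m| :=
    Finset.sum_nonneg fun i _ => by positivity
  calc (n : ℝ) * |∑' i, g (i + (n + 1))| ≤ n * ∑' i, |g (i + (n + 1))| := by gcongr
    _ = ∑' i, n * |g (i + (n + 1))| := by rw [tsum_mul_left]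
    _ ≤ ∑' i, ((i + (n + 1) : ℕ) : ℝ) * |g (i + (n + 1))| := by
        apply Summable.tsum_le_tsum _ (h0'.mul_left _) h1'
        intro i
        gcongr
        omega
    _ ≤ _ := by linarith

noncomputable def HH (n : ℕ) : ℝ := ∑ m ∈ Finset.range (n + 1), 1 / (m : ℝ)
noncomputable def hh (m : ℕ) : ℝ := 1 / (m : ℝ)

lemma SS_eq (a b : ℕ → ℝ) (n : ℕ) :
    SS a b n = ∑ i ∈ Finset.range (n + 1), a i * ∑ j ∈ Finset.range (n - i + 1), b j := by
  unfold SS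
  refine Finset.sum_congr rfl fun i hi => ?_
  rw [Finset.mem_range] at hi
  rw [Finset.mul_sum, ← Finset.sum_filter]
  apply Finset.sum_congr _ (fun _ _ => rfl)
  ext j
  simp only [Finset.mem_filter, Finset.mem_range]
  omega

lemma SS_comm (a b : ℕ → ℝ) (n : ℕ) : SS a b n = SS b a n := by
  unfold SS
  rw [Finset.sum_comm]
  refine Finset.sum_congr rfl fun i _ => Finset.sum_congr rfl fun j _ => ?_
  rw [add_comm, mul_comm]

lemma SS_add (a b : ℕ → ℝ) (n : ℕ) : SS (fun i => a i + b i) (fun i => a i + b i) n =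
    SS a a n + 2 * SS a b n + SS b b n := by
  have : SS (fun i => a i + b i) (fun i => a i + b i) n =
    SS a a n + SS a b n + SS b a n + SS b b n := by
    simp only [SS, ← Finset.sum_add_distrib]
    refine Finset.sum_congr rfl fun i _ => Finset.sum_congr rfl fun j _ => ?_
    split_ifs <;> ring
  rw [this, SS_comm b a]; ring

lemma HH_sub (n s : ℕ) (hs : s ≤ n) : 0 ≤ HH n - HH (n - s) ∧ n * (HH n - HH (n - s)) ≤ (s : ℝ) ^ 2 := by
  have e : HH n - HH (n - s) = ∑ i ∈ Finset.range s, 1 / ((n - s + 1 + i : ℕ) : ℝ) := by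
    have := Finset.sum_range_add (fun m : ℕ => 1 / (m : ℝ)) (n - s + 1) s
    rw [show n - s + 1 + s = n + 1 by omega] at this
    rw [HH, HH, this]; ring
  rw [e]
  constructor
  · exact Finset.sum_nonneg fun i _ => by positivity
  · rw [Finset.mul_sum]
    calc _ ≤ ∑ i ∈ Finset.range s, (s : ℝ) := by
          refine Finset.sum_le_sum fun i hi => ?_
          rw [Finset.mem_range] at hi
          rw [mul_one_div, div_le_iff₀ (by positivity)]
          have : n ≤ s * (n - s + 1 + i) := by
            obtain ⟨t, rfl⟩ := Nat.exists_eq_add_of_le hs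
            rw [Nat.add_sub_cancel_left]
            nlinarith [Nat.zero_le (s * i), Nat.mul_le_mul_right t (by omega : 1 ≤ s)]
          exact_mod_cast this
      _ = _ := by simp [sq]

/-- L2 -/
lemma SS_h (g : ℕ → ℝ) (h2 : Summable (fun m : ℕ => (m : ℝ) ^ 2 * |g m|)) :
    (fun n : ℕ => SS hh g n - HH n * ∑ m ∈ Finset.range (n + 1), g m) =O[atTop]
      (fun n : ℕ => 1 / (n : ℝ)) := by
  apply bigO_of_bound _ (∑' m : ℕ, (m : ℝ) ^ 2 * |g m|)
  intro n hn
  have : SS hh g n - HH n * ∑ m ∈ Finset.range (n + 1), g m =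
      - ∑ m ∈ Finset.range (n + 1), g m * (HH n - HH (n - m)) := by
    rw [SS_comm, SS_eq, Finset.mul_sum, ← Finset.sum_sub_distrib, ← Finset.sum_neg_distrib]
    refine Finset.sum_congr rfl fun i _ => ?_
    have : ∑ j ∈ Finset.range (n - i + 1), hh j = HH (n - i) := rfl
    rw [this]; ring
  rw [this, abs_neg]
  calc _ ≤ (n : ℝ) * ∑ m ∈ Finset.range (n + 1), |g m * (HH n - HH (n - m))| := by
        gcongr; exact Finset.abs_sum_le_sum_abs _ _
    _ = ∑ m ∈ Finset.range (n + 1), n * |g m * (HH n - HH (n - m))| := by rw [Finset.mul_sum]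
    _ ≤ ∑ m ∈ Finset.range (n + 1), (m : ℝ) ^ 2 * |g m| := by
        refine Finset.sum_le_sum fun m hm => ?_
        rw [Finset.mem_range] at hm
        obtain ⟨h3, h4⟩ := HH_sub n m (by omega)
        rw [abs_mul, abs_of_nonneg h3]
        nlinarith [abs_nonneg (g m)]
    _ ≤ _ := h2.sum_le_tsum _ (fun i _ => by positivity)

/-- L3 -/
lemma SS_gg (g : ℕ → ℝ) (h0 : Summable (fun m : ℕ => |g m|))
    (h1 : Summable (fun m : ℕ => (m : ℝ) * |g m|)) :
    (fun n : ℕ => SS g g n - (∑ m ∈ Finset.range (n + 1), g m) ^ 2) =O[atTop]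
      (fun n : ℕ => 1 / (n : ℝ)) := by
  apply bigO_of_bound _ (2 * (∑' m : ℕ, (m : ℝ) * |g m|) * (∑' m : ℕ, |g m|))
  intro n hn
  have : SS g g n - (∑ m ∈ Finset.range (n + 1), g m) ^ 2 =
      ∑ i ∈ Finset.range (n + 1), ∑ j ∈ Finset.range (n + 1), if i + j ≤ n then 0 else - (g i * g j) := by
    rw [sq, Finset.sum_mul_sum, SS]
    simp_rw [← Finset.sum_sub_distrib]
    refine Finset.sum_congr rfl fun i _ => Finset.sum_congr rfl fun j _ => ?_
    split_ifs <;> ring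
  rw [this]
  have k0 := h0.sum_le_tsum (Finset.range (n + 1)) (fun i _ => by positivity)
  have k1 := h1.sum_le_tsum (Finset.range (n + 1)) (fun i _ => by positivity)
  have p0 : 0 ≤ ∑ m ∈ Finset.range (n + 1), |g m| := Finset.sum_nonneg fun i _ => by positivity
  have p1 : 0 ≤ ∑' m : ℕ, (m : ℝ) * |g m| := tsum_nonneg fun i => by positivity
  calc _ ≤ (n : ℝ) * ∑ i ∈ Finset.range (n + 1), ∑ j ∈ Finset.range (n + 1),
          |if i + j ≤ n then 0 else - (g i * g j)| := by
        gcongr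
        refine (Finset.abs_sum_le_sum_abs _ _).trans (Finset.sum_le_sum fun i _ => ?_)
        exact Finset.abs_sum_le_sum_abs _ _
    _ = ∑ i ∈ Finset.range (n + 1), ∑ j ∈ Finset.range (n + 1),
          n * |if i + j ≤ n then 0 else - (g i * g j)| := by simp_rw [Finset.mul_sum]
    _ ≤ ∑ i ∈ Finset.range (n + 1), ∑ j ∈ Finset.range (n + 1),
          ((i * |g i|) * |g j| + |g i| * (j * |g j|)) := by
        refine Finset.sum_le_sum fun i _ => Finset.sum_le_sum fun j _ => ?_
        split_ifs with h
        · rw [abs_zero, mul_zero]; positivity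
        · rw [abs_neg, abs_mul]
          have : (n : ℝ) ≤ i + j := by exact_mod_cast (not_le.1 h).le
          nlinarith [mul_nonneg (abs_nonneg (g i)) (abs_nonneg (g j))]
    _ = 2 * (∑ i ∈ Finset.range (n + 1), i * |g i|) * (∑ i ∈ Finset.range (n + 1), |g i|) := by
        simp_rw [Finset.sum_add_distrib, ← Finset.sum_mul_sum]
        ring
    _ ≤ _ := by gcongr

noncomputable def H2 (n : ℕ) : ℝ := ∑ m ∈ Finset.range (n + 1), 1 / (m : ℝ) ^ 2

lemma HH_succ (n : ℕ) : HH (n + 1) = HH n + 1 / ((n : ℝ) + 1) := by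
  rw [HH, Finset.sum_range_succ, ← HH]; push_cast; rfl

lemma H2_succ (n : ℕ) : H2 (n + 1) = H2 n + 1 / ((n : ℝ) + 1) ^ 2 := by
  rw [H2, Finset.sum_range_succ, ← H2]; push_cast; rfl

lemma HH_eq (n : ℕ) : HH n = ∑ i ∈ Finset.range n, 1 / ((i : ℝ) + 1) := by
  rw [HH, Finset.sum_range_succ']; simp

lemma SS_hh (n : ℕ) : SS hh hh n = HH n ^ 2 - H2 n := by
  have key : ∀ n, SS hh hh n = ∑ i ∈ Finset.range (n + 1), hh i * HH (n - i) := fun n => SS_eq _ _ _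
  induction n with
  | zero => simp [SS, hh, HH, H2]
  | succ n ih =>
    rw [key] at ih ⊢
    rw [HH_succ, H2_succ, Finset.sum_range_succ, Nat.sub_self]
    have h0 : HH 0 = 0 := by simp [HH]
    rw [h0, mul_zero, add_zero]
    have e1 : ∀ i ∈ Finset.range (n + 1), hh i * HH (n + 1 - i) =
        hh i * HH (n - i) + hh i * hh (n + 1 - i) := by
      intro i hi
      rw [Finset.mem_range] at hi
      rw [show n + 1 - i = (n - i) + 1 by omega, HH_succ, hh, hh]
      push_cast
      ring
    rw [Finset.sum_congr rfl e1, Finset.sum_add_distrib, ih, Finset.sum_range_succ']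
    have h00 : hh 0 = 0 := by simp [hh]
    rw [h00, zero_mul, add_zero]
    have e2 : ∀ i ∈ Finset.range n, hh (i + 1) * hh (n + 1 - (i + 1)) =
        1 / ((n : ℝ) + 1) * (hh (i + 1) + hh (n - 1 - i + 1)) := by
      intro i hi
      rw [Finset.mem_range] at hi
      obtain ⟨t, rfl⟩ := Nat.exists_eq_add_of_lt hi
      rw [show i + t + 1 + 1 - (i + 1) = t + 1 by omega, show i + t + 1 - 1 - i + 1 = t + 1 by omega]
      simp only [hh]
      push_cast
      field_simp
      ring
    rw [Finset.sum_congr rfl e2, ← Finset.mul_sum, Finset.sum_add_distrib,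
      Finset.sum_range_reflect (fun i => hh (i + 1)) n]
    have e3 : ∑ i ∈ Finset.range n, hh (i + 1) = HH n := by
      rw [HH_eq]; simp [hh]
    rw [e3]
    field_simp
    ring

lemma HH_asymp : (fun n : ℕ => HH n - Real.log n - Real.eulerMascheroniConstant) =O[atTop]
      (fun n : ℕ => 1 / (n : ℝ)) := by
  apply bigO_of_bound _ 1
  intro n hn
  have hn' : (0 : ℝ) < n := by exact_mod_cast hn
  have a := Real.eulerMascheroniSeq_lt_eulerMascheroniConstant n
  have b := Real.eulerMascheroniConstant_lt_eulerMascheroniSeq' n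
  have hH : HH n = (harmonic n : ℝ) := by
    rw [HH_eq, harmonic]; push_cast; simp
  rw [Real.eulerMascheroniSeq, ← hH] at a
  rw [Real.eulerMascheroniSeq', if_neg (by omega), ← hH] at b
  have c : Real.log (n + 1) - Real.log n ≤ 1 / n := by
    rw [← Real.log_div (by positivity) (by positivity)]
    refine (Real.log_le_sub_one_of_pos (by positivity)).trans (le_of_eq ?_)
    field_simp; ring
  rw [abs_of_nonneg (by linarith)]
  calc _ ≤ (n : ℝ) * (1 / n) := by gcongr; linarith
    _ = 1 := by field_simp

lemma H2_asymp : (fun n : ℕ => H2 n - π ^ 2 / 6) =O[atTop] (fun n : ℕ => 1 / (n : ℝ)) := by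
  apply bigO_of_bound _ 1
  intro n hn
  have hn' : (0 : ℝ) < n := by exact_mod_cast hn
  have hz := hasSum_zeta_two
  have a : H2 n ≤ π ^ 2 / 6 := sum_le_hasSum _ (fun i _ => by positivity) hz
  have b : π ^ 2 / 6 ≤ H2 n + 1 / n := by
    have anti : Antitone (fun k : ℕ => H2 (k + 1) + 1 / ((k : ℝ) + 1)) := by
      apply antitone_nat_of_succ_le
      intro k
      rw [H2_succ (k + 1)]
      push_cast
      have : 1 / ((k : ℝ) + 1 + 1) ^ 2 + 1 / ((k : ℝ) + 1 + 1) ≤ 1 / ((k : ℝ) + 1) := by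
        rw [← sub_nonneg]
        have : 1 / ((k : ℝ) + 1) - (1 / ((k : ℝ) + 1 + 1) ^ 2 + 1 / ((k : ℝ) + 1 + 1)) =
          1 / (((k : ℝ) + 1) * ((k : ℝ) + 1 + 1) ^ 2) := by
          field_simp; ring
        rw [this]; positivity
      linarith
    have lim : Tendsto (fun k : ℕ => H2 (k + 1) + 1 / ((k : ℝ) + 1)) atTop (nhds (π ^ 2 / 6)) := by
      have := (hz.tendsto_sum_nat.comp (tendsto_add_atTop_nat 2)).add
        tendsto_one_div_add_atTop_nhds_zero_nat
      rw [add_zero] at this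
      exact this
    have := anti.le_of_tendsto lim (n - 1)
    rw [show n - 1 + 1 = n by omega, Nat.cast_sub hn] at this
    simpa using this
  rw [abs_of_nonpos (by linarith)]
  calc _ ≤ (n : ℝ) * (1 / n) := by gcongr; linarith
    _ = 1 := by field_simp
end Analytic
noncomputable def gg (F : Type*) [Field F] [Fintype F] (m : ℕ) : ℝ := ee F m - bb F 2 m

lemma one_div_bigO : (fun n : ℕ => 1 / (n : ℝ)) =O[atTop] (fun n : ℕ => Real.log n / (n : ℝ)) := by
  apply IsBigO.of_bound 1
  have h : ∀ᶠ n : ℕ in atTop, 1 ≤ Real.log n :=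
    (Real.tendsto_log_atTop.comp tendsto_natCast_atTop_atTop).eventually_ge_atTop 1
  filter_upwards [h] with n hn
  rw [Real.norm_of_nonneg (by positivity), Real.norm_of_nonneg (by positivity), one_mul]
  gcongr

lemma normalized (F : Type*) [Field F] [Fintype F] :
    (fun n : ℕ => (SS (fun m => bb F 1 m - bb F 2 m) (fun m => bb F 1 m - bb F 2 m) n
      - (∑ m ∈ Finset.range (n + 1), bb F 2 m - 2 * ∑ m ∈ Finset.range (n + 1), bb F 3 m
          + ∑ m ∈ Finset.range (n + 1), bb F 4 m)
      + (∑ m ∈ Finset.range (n + 1), bb F 1 m - ∑ m ∈ Finset.range (n + 1), bb F 2 m))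
      - ((Real.log n) ^ 2 + (1 + 2 * A1 F - 2 * Lc F 2) * Real.log n +
            ((A1 F - 2 * Lc F 2) * (A1 F + 1) - Real.pi ^ 2 / 6 + (Lc F 2) ^ 2 +
              2 * Lc F 3 - Lc F 4))) =O[atTop] (fun n : ℕ => Real.log n / (n : ℝ)) := by
  have hr := (rho_pos F).le
  have hr1 := rho_lt_one F
  have hgb : ∀ m, |gg F m| ≤ 3 * rho F ^ m := fun m => by
    have h1 := ee_bound F m
    have h2 := bb_bound F 2 m le_rfl
    have h3 := abs_sub (ee F m) (bb F 2 m)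
    rw [gg]; linarith
  have hbb : ∀ k, 2 ≤ k → ∀ m, |bb F k m| ≤ 1 * rho F ^ m := fun k hk m => by
    rw [one_mul]; exact bb_bound F k m hk
  have s0 : ∀ (g : ℕ → ℝ) (C : ℝ), (∀ m, |g m| ≤ C * rho F ^ m) → Summable (fun m => |g m|) := by
    intro g C h
    simpa using summable_pow_mul_abs g C _ hr hr1 h 0
  have s1 : ∀ (g : ℕ → ℝ) (C : ℝ), (∀ m, |g m| ≤ C * rho F ^ m) →
      Summable (fun m : ℕ => (m : ℝ) * |g m|) := by
    intro g C h
    simpa using summable_pow_mul_abs g C _ hr hr1 h 1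
  have hG : ∑' m, gg F m = A1 F - Real.eulerMascheroniConstant - Lc F 2 := by
    rw [A1_eq, Lc_eq F 2 le_rfl]
    have a : Summable (ee F) := (s0 _ 2 (ee_bound F)).of_abs
    have b : Summable (bb F 2) := (s0 _ 1 (hbb 2 le_rfl)).of_abs
    simp only [gg]
    rw [a.tsum_sub b]; ring
  have d1 := HH_asymp
  have d2 := partial_sum (gg F) (s0 _ _ hgb) (s1 _ _ hgb)
  have d3 := SS_h (gg F) (summable_pow_mul_abs _ _ _ hr hr1 hgb 2)
  have d4 := SS_gg (gg F) (s0 _ _ hgb) (s1 _ _ hgb)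
  have d5 := partial_sum (bb F 2) (s0 _ _ (hbb 2 (by norm_num))) (s1 _ _ (hbb 2 (by norm_num)))
  have d6 := partial_sum (bb F 3) (s0 _ _ (hbb 3 (by norm_num))) (s1 _ _ (hbb 3 (by norm_num)))
  have d7 := partial_sum (bb F 4) (s0 _ _ (hbb 4 (by norm_num))) (s1 _ _ (hbb 4 (by norm_num)))
  have d8 := H2_asymp
  rw [hG] at d2
  rw [← Lc_eq F 2 (by norm_num)] at d5
  rw [← Lc_eq F 3 (by norm_num)] at d6
  rw [← Lc_eq F 4 (by norm_num)] at d7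
  -- X
  have hlog : Tendsto (fun n : ℕ => Real.log n) atTop atTop :=
    Real.tendsto_log_atTop.comp tendsto_natCast_atTop_atTop
  have hconst : ∀ c : ℝ, (fun _ : ℕ => c) =O[atTop] (fun n : ℕ => Real.log n) := fun c =>
    (isLittleO_const_left.2 (Or.inr (tendsto_norm_atTop_atTop.comp hlog))).isBigO
  have hX : (fun n : ℕ => 2 * (Real.log n + (A1 F - Lc F 2)) + 1) =O[atTop] (fun n : ℕ => Real.log n) :=
    (((isBigO_refl _ _).add (hconst _)).const_mul_left 2).add (hconst 1)
  have d := d1.add d2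
  have t1 := hX.mul d
  have hd1 : (fun n : ℕ => 1 / (n : ℝ)) =O[atTop] (fun _ : ℕ => (1 : ℝ)) :=
    (tendsto_one_div_atTop_nhds_zero_nat).isBigO_one ℝ
  have t2 := d.mul (d.trans hd1)
  simp only [mul_one] at t2
  simp only [mul_one_div] at t1
  have t3 := ((((t2.sub d8).add (d3.const_mul_left 2)).add d4).sub
    ((d5.sub (d6.const_mul_left 2)).add d7)).trans one_div_bigO
  refine (t1.add t3).congr_left fun n => ?_
  have e1 : (fun m => bb F 1 m - bb F 2 m) = fun m => hh m + gg F m := by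
    funext m; rw [gg, ee, hh]; ring
  have e2 : ∑ m ∈ Finset.range (n + 1), bb F 1 m - ∑ m ∈ Finset.range (n + 1), bb F 2 m =
      HH n + ∑ m ∈ Finset.range (n + 1), gg F m := by
    rw [HH, ← Finset.sum_sub_distrib, ← Finset.sum_add_distrib]
    refine Finset.sum_congr rfl fun m _ => ?_
    rw [gg, ee]; ring
  rw [e1, e2, SS_add, SS_hh]
  ring

/-- Second moment of ω₁ over monic polynomials of degree n. -/
theorem second_moment_omega_one (F : Type*) [Field F] [Fintype F] :
    (fun n : ℕ =>
        (∑ᶠ f ∈ {f : Polynomial F | f.Monic ∧ f.natDegree = n},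
            (omegak F 1 f : ℝ) ^ 2) -
          ((Fintype.card F : ℝ) ^ n * (Real.log n) ^ 2 +
            (1 + 2 * A1 F - 2 * Lc F 2) * (Fintype.card F : ℝ) ^ n * Real.log n +
            ((A1 F - 2 * Lc F 2) * (A1 F + 1) - Real.pi ^ 2 / 6 + (Lc F 2) ^ 2 +
              2 * Lc F 3 - Lc F 4) * (Fintype.card F : ℝ) ^ n))
      =O[atTop] (fun n : ℕ => (Fintype.card F : ℝ) ^ n * Real.log n / n) := by
  have h := (isBigO_refl (fun n : ℕ => (Fintype.card F : ℝ) ^ n) atTop).mul (normalized F)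
  refine (h.congr_left fun n => ?_).congr_right fun n => ?_
  · rw [moment_eq]; ring
  · ring
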